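/- arXiv:2010.05018 — 2 statements merged into one kernel-verified Lean document; each statement's English description precedes it below -/
import Mathlib

section
/- For all real numbers q ∈ (0,1), −γ·q·log(1−q)/(1−q) − log²(1−q)/log(q) < ∑_{k=2}^∞ (∑_{j=1}^{k−1} d(j)/(k−j)) q^k < −q·log(1−q)/(1−q) − log²(1−q)/log(q), where γ is the Euler–Mascheroni constant. -/
/-- `d k = ` number of positive divisors of `k` -/
noncomputable def numDivisors (k : ℕ) : ℕ := k.divisors.card

open Filter Topology Finset

/-- The Lambert series `∑_{n ≥ 1} q ^ n / (1 - q ^ n)`. -/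
noncomputable def lambertSeries (q : ℝ) : ℝ := ∑' n : ℕ, q ^ (n + 1) / (1 - q ^ (n + 1))

lemma summable_lambertSeries {q : ℝ} (h0 : 0 < q) (h1 : q < 1) :
    Summable fun n : ℕ ↦ q ^ (n + 1) / (1 - q ^ (n + 1)) := by
  have h := summable_norm_pow_mul_geometric_div_one_sub (𝕜 := ℝ) 0 (r := q)
    (by rwa [Real.norm_of_nonneg h0.le])
  simpa using (summable_nat_add_iff 1).2 h

lemma summable_numDivisors_mul_pow {q : ℝ} (h0 : 0 < q) (h1 : q < 1) :
    Summable fun n : ℕ ↦ (numDivisors (n + 1) : ℝ) * q ^ (n + 1) := by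
  have h := summable_pow_mul_geometric_of_norm_lt_one (R := ℝ) 1 (r := q)
    (by rwa [Real.norm_of_nonneg h0.le])
  refine Summable.of_nonneg_of_le (fun n ↦ by positivity) (fun n ↦ ?_)
    ((summable_nat_add_iff 1).2 h)
  rw [pow_one]
  gcongr
  exact Nat.card_divisors_le_self _

lemma tsum_numDivisors_mul_pow {q : ℝ} (h0 : 0 < q) (h1 : q < 1) :
    ∑' n : ℕ, (numDivisors (n + 1) : ℝ) * q ^ (n + 1) = lambertSeries q := by
  have h := tsum_pow_div_one_sub_eq_tsum_sigma (𝕜 := ℝ) (r := q)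
    (by rwa [Real.norm_of_nonneg h0.le]) 0
  rw [tsum_pnat_eq_tsum_succ (f := fun n : ℕ ↦ (n : ℝ) ^ 0 * q ^ n / (1 - q ^ n)),
    tsum_pnat_eq_tsum_succ (f := fun n : ℕ ↦ (ArithmeticFunction.sigma 0 n : ℝ) * q ^ n)] at h
  simp only [pow_zero, one_mul, ArithmeticFunction.sigma_zero_apply] at h
  exact h.symm

lemma tsum_divisor_convolution {q : ℝ} (h0 : 0 < q) (h1 : q < 1) :
    ∑' n : ℕ, (∑ j ∈ Icc 1 (n + 1), (numDivisors j : ℝ) / ((n + 2 : ℝ) - (j : ℝ))) * q ^ (n + 2)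
      = lambertSeries q * -Real.log (1 - q) := by
  have hlog := Real.hasSum_pow_div_log_of_abs_lt_one (x := q) (by rwa [abs_of_pos h0])
  have hd := summable_numDivisors_mul_pow h0 h1
  rw [← tsum_numDivisors_mul_pow h0 h1, ← hlog.tsum_eq,
    tsum_mul_tsum_eq_tsum_sum_range_of_summable_norm hd.norm hlog.summable.norm]
  refine tsum_congr fun n ↦ ?_
  rw [← Finset.Ico_add_one_right_eq_Icc, Finset.sum_Ico_eq_sum_range, Finset.sum_mul]
  refine Finset.sum_congr rfl fun k hk ↦ ?_
  have hk : k ≤ n := by simpa [Nat.lt_succ_iff] using hk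
  obtain ⟨m, rfl⟩ := Nat.exists_eq_add_of_le hk
  rw [Nat.add_sub_cancel_left, add_comm 1 k]
  have e : ((k + m : ℕ) : ℝ) + 2 - ((k + 1 : ℕ) : ℝ) = m + 1 := by push_cast; ring
  rw [e]
  ring

/-- `∑_{n = 1}^{N} q ^ n / (1 - q ^ n) - ∫_{1}^{N + 1} q ^ u / (1 - q ^ u) du`. -/
noncomputable def lambertDefect (q : ℝ) (N : ℕ) : ℝ :=
  ∑ n ∈ range N, q ^ (n + 1) / (1 - q ^ (n + 1)) +
    Real.log ((1 - q ^ (N + 1)) / (1 - q)) / Real.log q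

lemma lambertDefect_succ {q : ℝ} (h0 : 0 < q) (h1 : q < 1) (N : ℕ) :
    lambertDefect q (N + 1) = lambertDefect q N + (q ^ (N + 1) / (1 - q ^ (N + 1)) +
      Real.log ((1 - q ^ (N + 2)) / (1 - q ^ (N + 1))) / Real.log q) := by
  have a (n : ℕ) : 1 - q ^ (n + 1) ≠ 0 :=
    (sub_pos.2 (pow_lt_one₀ h0.le h1 (Nat.succ_ne_zero n))).ne'
  have b : 1 - q ≠ 0 := (sub_pos.2 h1).ne'
  rw [lambertDefect, lambertDefect, sum_range_succ, Real.log_div (a _) b, Real.log_div (a _) b,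
    Real.log_div (a (N + 1)) (a N)]
  ring

lemma monotone_lambertDefect {q : ℝ} (h0 : 0 < q) (h1 : q < 1) : Monotone (lambertDefect q) := by
  refine monotone_nat_of_le_succ fun N ↦ ?_
  rw [lambertDefect_succ h0 h1]
  have a (n : ℕ) : 0 < 1 - q ^ (n + 1) := sub_pos.2 (pow_lt_one₀ h0.le h1 (Nat.succ_ne_zero n))
  have hl := Real.log_neg h0 h1
  have ht : 1 - q ≤ -Real.log q := by linarith [Real.log_le_sub_one_of_pos h0]
  have h := Real.log_le_sub_one_of_pos (div_pos (a (N + 1)) (a N))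
  have e : (1 - q ^ (N + 1 + 1)) / (1 - q ^ (N + 1)) - 1
      = q ^ (N + 1) / (1 - q ^ (N + 1)) * (1 - q) := by
    field_simp [(a N).ne']
    ring
  rw [e] at h
  have hpos : 0 < q ^ (N + 1) / (1 - q ^ (N + 1)) := div_pos (by positivity) (a N)
  have h2 := h.trans (mul_le_mul_of_nonneg_left ht hpos.le)
  have h3 : -(q ^ (N + 1) / (1 - q ^ (N + 1))) ≤
      Real.log ((1 - q ^ (N + 2)) / (1 - q ^ (N + 1))) / Real.log q := by
    rw [le_div_iff_of_neg hl]
    linarith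
  linarith

lemma strictAnti_lambertDefect_add {q : ℝ} (h0 : 0 < q) (h1 : q < 1) :
    StrictAnti fun N ↦ lambertDefect q N + q ^ (N + 1) / (1 - q ^ (N + 1)) := by
  refine strictAnti_nat_of_succ_lt fun N ↦ ?_
  rw [lambertDefect_succ h0 h1]
  have a (n : ℕ) : 0 < 1 - q ^ (n + 1) := sub_pos.2 (pow_lt_one₀ h0.le h1 (Nat.succ_ne_zero n))
  have hl := Real.log_neg h0 h1
  have ht : q * -Real.log q < 1 - q := by
    have := Real.log_lt_sub_one_of_pos (inv_pos.2 h0) (one_lt_inv₀ h0 |>.2 h1).ne'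
    rw [Real.log_inv] at this
    calc q * -Real.log q < q * (q⁻¹ - 1) := by gcongr
      _ = 1 - q := by field_simp
  have h := Real.one_sub_inv_le_log_of_pos (div_pos (a (N + 1)) (a N))
  have e : 1 - ((1 - q ^ (N + 1 + 1)) / (1 - q ^ (N + 1)))⁻¹
      = q ^ (N + 1) / (1 - q ^ (N + 2)) * (1 - q) := by
    have := (a N).ne'
    have := (a (N + 1)).ne'
    field_simp
    ring
  rw [e] at h
  have hpos : 0 < q ^ (N + 1) / (1 - q ^ (N + 2)) := div_pos (by positivity) (a (N + 1))
  have h2 := (mul_lt_mul_of_pos_left ht hpos).trans_le h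
  have h3 : Real.log ((1 - q ^ (N + 2)) / (1 - q ^ (N + 1))) / Real.log q <
      -(q ^ (N + 2) / (1 - q ^ (N + 2))) := by
    rw [div_lt_iff_of_neg hl]
    convert h2 using 1
    ring
  change _ + q ^ (N + 2) / (1 - q ^ (N + 2)) < _
  linarith

lemma tendsto_lambertDefect {q : ℝ} (h0 : 0 < q) (h1 : q < 1) :
    Tendsto (lambertDefect q) atTop
      (𝓝 (lambertSeries q - Real.log (1 - q) / Real.log q)) := by
  have hp : Tendsto (fun N : ℕ ↦ q ^ (N + 1)) atTop (𝓝 0) :=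
    (tendsto_add_atTop_iff_nat 1).2 (tendsto_pow_atTop_nhds_zero_of_lt_one h0.le h1)
  have b : 1 - q ≠ 0 := (sub_pos.2 h1).ne'
  have hlog : Tendsto (fun N : ℕ ↦ Real.log ((1 - q ^ (N + 1)) / (1 - q)) / Real.log q) atTop
      (𝓝 (Real.log ((1 - 0) / (1 - q)) / Real.log q)) :=
    (((hp.const_sub 1).div_const (1 - q)).log (by simpa using b)).div_const _
  convert (summable_lambertSeries h0 h1).hasSum.tendsto_sum_nat.add hlog using 2
  · rfl
  · rw [sub_zero, one_div, Real.log_inv, neg_div, ← sub_eq_add_neg]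
    rfl

lemma lambertSeries_sub_lt {q : ℝ} (h0 : 0 < q) (h1 : q < 1) :
    lambertSeries q - Real.log (1 - q) / Real.log q < q / (1 - q) := by
  have hanti := strictAnti_lambertDefect_add h0 h1
  have ht := (tendsto_lambertDefect h0 h1).add
    (summable_lambertSeries h0 h1).tendsto_atTop_zero
  rw [add_zero] at ht
  refine (hanti.antitone.le_of_tendsto ht 1).trans_lt ((hanti zero_lt_one).trans_eq ?_)
  have b : 1 - q ≠ 0 := (sub_pos.2 h1).ne'
  simp [lambertDefect, div_self b]

lemma strictAntiOn_inv_one_sub_add_inv_log :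
    StrictAntiOn (fun x : ℝ ↦ (1 - x)⁻¹ + (Real.log x)⁻¹) (Set.Ioo 0 1) := by
  have hd (x : ℝ) (hx : x ∈ Set.Ioo (0 : ℝ) 1) :
      HasDerivAt (fun x : ℝ ↦ (1 - x)⁻¹ + (Real.log x)⁻¹)
        (-(-1) / (1 - x) ^ 2 + -x⁻¹ / Real.log x ^ 2) x :=
    (((hasDerivAt_id x).const_sub 1).inv (sub_pos.2 hx.2).ne').add
      ((Real.hasDerivAt_log hx.1.ne').inv (Real.log_neg hx.1 hx.2).ne)
  refine strictAntiOn_of_deriv_neg (convex_Ioo 0 1)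
    (fun x hx ↦ (hd x hx).continuousAt.continuousWithinAt) fun x hx ↦ ?_
  rw [interior_Ioo] at hx
  rw [(hd x hx).deriv]
  obtain ⟨u, hu, rfl⟩ : ∃ u, 0 < u ∧ x = Real.exp (-u) ^ 2 := by
    refine ⟨-Real.log x / 2, by linarith [Real.log_neg hx.1 hx.2], ?_⟩
    rw [← Real.exp_nat_mul, ← Real.exp_log hx.1]
    simp
    ring_nf
  have hlog : Real.log (Real.exp (-u) ^ 2) = -(2 * u) := by
    rw [Real.log_pow, Real.log_exp]
    push_cast
    ring
  have hsub : 1 - Real.exp (-u) ^ 2 = 2 * Real.exp (-u) * Real.sinh u := by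
    have : Real.exp (-u) * Real.exp u = 1 := by rw [← Real.exp_add]; simp
    rw [Real.sinh_eq]
    linear_combination -this
  have hs := Real.self_lt_sinh_iff.2 hu
  have he := Real.exp_pos (-u)
  have hsq : u ^ 2 < Real.sinh u ^ 2 := by gcongr
  rw [hlog, hsub]
  have h3 : -(-1) / (2 * Real.exp (-u) * Real.sinh u) ^ 2 +
      -(Real.exp (-u) ^ 2)⁻¹ / (-(2 * u)) ^ 2 =
      (4 * Real.exp (-u) ^ 2)⁻¹ * ((Real.sinh u ^ 2)⁻¹ - (u ^ 2)⁻¹) := by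
    have := (hu.trans hs).ne'
    field_simp
    ring
  rw [h3]
  refine mul_neg_of_pos_of_neg (by positivity) (sub_neg.2 ?_)
  gcongr

/-- A `q`-analogue of the Euler–Mascheroni constant. -/
noncomputable def qEulerConstant (q : ℝ) : ℝ :=
  (1 - q) / q * (lambertSeries q - Real.log (1 - q) / Real.log q)

lemma hasSum_qEulerConstant {q : ℝ} (h0 : 0 < q) (h1 : q < 1) :
    HasSum (fun n : ℕ ↦ (1 - q) * q ^ n * ((1 - q ^ (n + 1))⁻¹ + (Real.log (q ^ (n + 1)))⁻¹))
      (qEulerConstant q) := by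
  have hlog := Real.hasSum_pow_div_log_of_abs_lt_one (x := q) (by rwa [abs_of_pos h0])
  have h := ((summable_lambertSeries h0 h1).hasSum.add (hlog.div_const (Real.log q))).mul_left
    ((1 - q) / q)
  have hval : (1 - q) / q * (∑' n : ℕ, q ^ (n + 1) / (1 - q ^ (n + 1)) +
      -Real.log (1 - q) / Real.log q) = qEulerConstant q := by
    rw [neg_div, ← sub_eq_add_neg]
    rfl
  rw [hval] at h
  refine h.congr_fun fun n ↦ ?_
  have hl := (Real.log_neg h0 h1).ne
  rw [Real.log_pow]
  push_cast
  have : (n + 1 : ℝ) ≠ 0 := by positivity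
  field_simp
  ring

lemma qEulerConstant_lt_sq {q : ℝ} (h0 : 0 < q) (h1 : q < 1) :
    qEulerConstant q < qEulerConstant (q ^ 2) := by
  have hs := hasSum_qEulerConstant h0 h1
  have h2 := hasSum_qEulerConstant (pow_pos h0 2) (pow_lt_one₀ h0.le h1 two_ne_zero)
  have inj : Function.Injective fun n : ℕ ↦ 2 * n := mul_right_injective₀ two_ne_zero
  have he := (hs.summable.comp_injective inj).hasSum
  have ho := (hs.summable.comp_injective (add_left_injective 1 |>.comp inj)).hasSum
  have hlt (n : ℕ) : (1 - q) * q ^ (2 * n) *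
        ((1 - q ^ (2 * n + 1))⁻¹ + (Real.log (q ^ (2 * n + 1)))⁻¹) +
      (1 - q) * q ^ (2 * n + 1) *
        ((1 - q ^ (2 * n + 1 + 1))⁻¹ + (Real.log (q ^ (2 * n + 1 + 1)))⁻¹) <
      (1 - q ^ 2) * (q ^ 2) ^ n *
        ((1 - (q ^ 2) ^ (n + 1))⁻¹ + (Real.log ((q ^ 2) ^ (n + 1)))⁻¹) := by
    have hm (k : ℕ) : q ^ (k + 1) ∈ Set.Ioo (0 : ℝ) 1 :=
      ⟨by positivity, pow_lt_one₀ h0.le h1 (Nat.succ_ne_zero k)⟩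
    have := strictAntiOn_inv_one_sub_add_inv_log (hm (2 * n + 1)) (hm (2 * n))
      (pow_lt_pow_right_of_lt_one₀ h0 h1 (Nat.lt_succ_self _))
    have hp : 0 < (1 - q) * q ^ (2 * n) := mul_pos (sub_pos.2 h1) (by positivity)
    have := mul_lt_mul_of_pos_left this hp
    simp only [← pow_mul, mul_add, mul_one] at this ⊢
    linear_combination this
  rw [hs.unique (he.even_add_odd ho)]
  exact hasSum_lt (fun n ↦ (hlt n).le) (hlt 0) (he.add ho) h2

lemma tendsto_mul_lambertDefect (N : ℕ) :
    Tendsto (fun q ↦ (1 - q) / q * lambertDefect q N) (𝓝[<] 1)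
      (𝓝 (Real.eulerMascheroniSeq N)) := by
  have hslope : Tendsto (fun q : ℝ ↦ (q - 1)⁻¹ * Real.log q) (𝓝[<] 1) (𝓝 1) := by
    have := (Real.hasDerivAt_log one_ne_zero).tendsto_slope
    have := this.mono_left (nhdsWithin_mono 1 fun x (hx : x ∈ Set.Iio 1) ↦ ne_of_lt hx)
    simpa [slope_fun_def, smul_eq_mul] using this
  have hid : Tendsto (fun q : ℝ ↦ q) (𝓝[<] 1) (𝓝 1) := tendsto_id.mono_left nhdsWithin_le_nhds
  have hgeom (n : ℕ) : Tendsto (fun q : ℝ ↦ ∑ i ∈ range n, q ^ i) (𝓝[<] 1) (𝓝 n) := by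
    simpa using tendsto_finsetSum (range n) fun i _ ↦ hid.pow i
  have hsum : Tendsto (fun q : ℝ ↦ ∑ n ∈ range N, q ^ n / ∑ i ∈ range (n + 1), q ^ i) (𝓝[<] 1)
      (𝓝 (∑ n ∈ range N, (1 : ℝ) ^ n / (n + 1 : ℕ))) :=
    tendsto_finsetSum _ fun n _ ↦ (hid.pow n).div (hgeom (n + 1)) (by positivity)
  have hlog := (hgeom (N + 1)).log (by positivity)
  have h := hsum.sub (((hslope.inv₀ one_ne_zero).mul (hid.inv₀ one_ne_zero)).mul hlog)
  have hlim : ∑ n ∈ range N, (1 : ℝ) ^ n / (n + 1 : ℕ) - 1⁻¹ * 1⁻¹ * Real.log (N + 1 : ℕ)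
      = Real.eulerMascheroniSeq N := by
    simp [Real.eulerMascheroniSeq, harmonic]
  rw [hlim] at h
  refine h.congr' ?_
  filter_upwards [Ioo_mem_nhdsLT zero_lt_one] with q ⟨h0, h1⟩
  have hg (n : ℕ) : 1 - q ^ n = (1 - q) * ∑ i ∈ range n, q ^ i := (mul_neg_geom_sum q n).symm
  have b : 1 - q ≠ 0 := (sub_pos.2 h1).ne'
  rw [lambertDefect, mul_add, mul_sum, hg (N + 1), mul_div_cancel_left₀ _ b, sub_eq_add_neg]
  congr 1
  · refine sum_congr rfl fun n _ ↦ ?_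
    rw [hg (n + 1)]
    have : ∑ i ∈ range (n + 1), q ^ i ≠ 0 := (geom_sum_pos h0.le n.succ_ne_zero).ne'
    field_simp
    ring
  · rw [mul_inv, inv_inv]
    ring

lemma eulerMascheroniConstant_lt_qEulerConstant {q : ℝ} (h0 : 0 < q) (h1 : q < 1) :
    Real.eulerMascheroniConstant < qEulerConstant q := by
  set r : ℕ → ℝ := fun k ↦ q ^ ((1 / 2 : ℝ) ^ k) with hr
  have hpos (k : ℕ) : 0 < r k := Real.rpow_pos_of_pos h0 _
  have hlt (k : ℕ) : r k < 1 := Real.rpow_lt_one h0.le h1 (by positivity)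
  have hsq (k : ℕ) : r (k + 1) ^ 2 = r k := by
    rw [hr, ← Real.rpow_mul_natCast h0.le]
    congr 1
    push_cast
    ring
  have hanti : StrictAnti fun k ↦ qEulerConstant (r k) :=
    strictAnti_nat_of_succ_lt fun k ↦ by
      simpa only [hsq] using qEulerConstant_lt_sq (hpos (k + 1)) (hlt (k + 1))
  have hr1 : Tendsto r atTop (𝓝[<] 1) := by
    refine tendsto_nhdsWithin_iff.2 ⟨?_, Eventually.of_forall hlt⟩
    have h : Tendsto (fun k : ℕ ↦ (1 / 2 : ℝ) ^ k) atTop (𝓝 0) :=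
      tendsto_pow_atTop_nhds_zero_of_lt_one (by norm_num) (by norm_num)
    simpa [hr, Function.comp_def] using ((Real.continuous_const_rpow h0.ne').tendsto 0).comp h
  have hle : Real.eulerMascheroniConstant ≤ qEulerConstant (r 1) := by
    refine le_of_tendsto' Real.tendsto_eulerMascheroniSeq fun N ↦ ?_
    refine le_of_tendsto ((tendsto_mul_lambertDefect N).comp hr1) ?_
    filter_upwards [eventually_ge_atTop 1] with k hk
    refine le_trans ?_ (hanti.antitone hk)
    exact mul_le_mul_of_nonneg_left
      ((monotone_lambertDefect (hpos k) (hlt k)).ge_of_tendsto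
        (tendsto_lambertDefect (hpos k) (hlt k)) N)
      (div_nonneg (sub_nonneg.2 (hlt k).le) (hpos k).le)
  refine hle.trans_lt ((hanti zero_lt_one).trans_eq ?_)
  simp [hr]

/-- For `q ∈ (0,1)`:
`-γ q log(1-q)/(1-q) - log²(1-q)/log q < ∑_{k=2}^∞ (∑_{j=1}^{k-1} d(j)/(k-j)) q^k
  < -q log(1-q)/(1-q) - log²(1-q)/log q`.
The series is indexed by `k = n + 2`, `n : ℕ`; the inner sum runs over `j = 1, ..., k - 1`. -/
theorem divisor_convolution_series_bounds (q : ℝ) (hq : q ∈ Set.Ioo (0 : ℝ) 1) :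
    -(Real.eulerMascheroniConstant * (q * Real.log (1 - q) / (1 - q))) -
        Real.log (1 - q) ^ 2 / Real.log q <
        (∑' n : ℕ, (∑ j ∈ Finset.Icc 1 (n + 1),
          (numDivisors j : ℝ) / ((n + 2 : ℝ) - (j : ℝ))) * q ^ (n + 2)) ∧
      (∑' n : ℕ, (∑ j ∈ Finset.Icc 1 (n + 1),
          (numDivisors j : ℝ) / ((n + 2 : ℝ) - (j : ℝ))) * q ^ (n + 2)) <
        -(q * Real.log (1 - q) / (1 - q)) - Real.log (1 - q) ^ 2 / Real.log q := by
  obtain ⟨h0, h1⟩ := hq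
  rw [tsum_divisor_convolution h0 h1]
  have hl : 0 < -Real.log (1 - q) := neg_pos.2 (Real.log_neg (sub_pos.2 h1) (by linarith))
  have b : 0 < 1 - q := sub_pos.2 h1
  have hlow : Real.eulerMascheroniConstant * (q / (1 - q)) <
      lambertSeries q - Real.log (1 - q) / Real.log q := by
    have h := mul_lt_mul_of_pos_right (eulerMascheroniConstant_lt_qEulerConstant h0 h1)
      (div_pos h0 b)
    refine h.trans_eq ?_
    rw [qEulerConstant]
    field_simp
  have hlow := mul_lt_mul_of_pos_right hlow hl
  have hup := mul_lt_mul_of_pos_right (lambertSeries_sub_lt h0 h1) hl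
  constructor
  · linear_combination hlow
  · linear_combination hup
end

section
/- Let q ∈ (0,1). If there exists an integer m ≥ 1 such that C_q(m) > 0, then C_q(n) ≥ C_q(m) for all integers n ≥ m. -/
/-- `φ_q(x) = q^x (q^x - qx + x - 1) / (1 - q^x)²`, with `q^x` the real power. -/
noncomputable def phi (q x : ℝ) : ℝ := q ^ x * (q ^ x - q * x + x - 1) / (1 - q ^ x) ^ 2

/-- `σ_q(j) = ∫_j^{j+1} φ_q(x) dx - φ_q(j+1)`. -/
noncomputable def sigmaQ (q : ℝ) (j : ℕ) : ℝ :=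
  (∫ x in (j : ℝ)..((j : ℝ) + 1), phi q x) - phi q ((j : ℝ) + 1)

/-- `C_q(n) = ∑_{j=1}^n σ_q(j)`. -/
noncomputable def CQ (q : ℝ) (n : ℕ) : ℝ := ∑ j ∈ Finset.Icc 1 n, sigmaQ q j

/-- The factor of `phi q` that carries the sign of its derivative: for `x > 0`,
`φ_q'(x) = q^x * phiSlope q x / (1 - q^x)^3`. -/
noncomputable def phiSlope (q x : ℝ) : ℝ :=
  (1 - q - Real.log q) * (1 - q ^ x) + Real.log q * (1 - q) * x * (1 + q ^ x)

theorem hasDerivAt_const_rpow_of_pos {q : ℝ} (hq : 0 < q) (x : ℝ) :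
    HasDerivAt (fun y : ℝ => q ^ y) (q ^ x * Real.log q) x :=
  (Real.hasStrictDerivAt_const_rpow hq x).hasDerivAt

theorem hasDerivAt_phi {q x : ℝ} (hq : q ∈ Set.Ioo (0 : ℝ) 1) (hx : 0 < x) :
    HasDerivAt (phi q) (q ^ x * phiSlope q x / (1 - q ^ x) ^ 3) x := by
  have hlt : q ^ x < 1 := Real.rpow_lt_one hq.1.le hq.2 hx
  have hne : 1 - q ^ x ≠ 0 := by linarith
  have hd := hasDerivAt_const_rpow_of_pos hq.1 x
  have hnum := hd.mul (((hd.sub ((hasDerivAt_id x).const_mul q)).add (hasDerivAt_id x)).sub_const 1)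
  have h := hnum.div ((hd.const_sub 1).pow 2) (pow_ne_zero 2 hne)
  refine h.congr_deriv ?_
  simp only [Pi.add_apply, Pi.sub_apply, Pi.mul_apply, Pi.pow_apply, id, phiSlope]
  field_simp
  ring

theorem hasDerivAt_phiSlope {q : ℝ} (hq : 0 < q) (x : ℝ) :
    HasDerivAt (phiSlope q)
      (Real.log q * (Real.log q * q ^ x + (1 - q) + Real.log q * (1 - q) * x * q ^ x)) x := by
  have hd := hasDerivAt_const_rpow_of_pos hq x
  have h := ((hd.const_sub 1).const_mul (1 - q - Real.log q)).add
    (((hasDerivAt_id x).const_mul (Real.log q * (1 - q))).mul (hd.const_add 1))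
  refine h.congr_deriv ?_
  simp only [id]
  ring

theorem hasDerivAt_deriv_phiSlope {q : ℝ} (hq : 0 < q) (x : ℝ) :
    HasDerivAt (deriv (phiSlope q))
      (Real.log q ^ 2 * q ^ x * (Real.log q + (1 - q) + Real.log q * (1 - q) * x)) x := by
  have hd := hasDerivAt_const_rpow_of_pos hq x
  have h := ((((hd.const_mul (Real.log q)).add_const (1 - q))).add
    (((hasDerivAt_id x).const_mul (Real.log q * (1 - q))).mul hd)).const_mul (Real.log q)
  rw [show deriv (phiSlope q) = _ from funext fun y => (hasDerivAt_phiSlope hq y).deriv]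
  refine h.congr_deriv ?_
  simp only [id]
  ring

theorem concaveOn_phiSlope {q : ℝ} (hq : q ∈ Set.Ioo (0 : ℝ) 1) :
    ConcaveOn ℝ (Set.Ici 0) (phiSlope q) := by
  refine concaveOn_of_deriv2_nonpos (convex_Ici 0)
    (fun x _ => (hasDerivAt_phiSlope hq.1 x).continuousAt.continuousWithinAt)
    (fun x _ => (hasDerivAt_phiSlope hq.1 x).differentiableAt.differentiableWithinAt)
    (fun x _ => (hasDerivAt_deriv_phiSlope hq.1 x).differentiableAt.differentiableWithinAt) ?_
  intro x hx
  rw [interior_Ici, Set.mem_Ioi] at hx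
  rw [show deriv^[2] (phiSlope q) x = deriv (deriv (phiSlope q)) x from rfl,
    (hasDerivAt_deriv_phiSlope hq.1 x).deriv]
  have hlog : Real.log q ≤ q - 1 := Real.log_le_sub_one_of_pos hq.1
  have hneg : Real.log q < 0 := Real.log_neg hq.1 hq.2
  have hpow : 0 < q ^ x := Real.rpow_pos_of_pos hq.1 x
  have hprod : 0 ≤ -Real.log q * (1 - q) * x :=
    mul_nonneg (mul_nonneg (by linarith) (by linarith [hq.2])) hx.le
  exact mul_nonpos_of_nonneg_of_nonpos (by positivity) (by linarith)

theorem phiSlope_nonpos_of_le {q x y : ℝ} (hq : q ∈ Set.Ioo (0 : ℝ) 1) (hx : 0 < x)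
    (hxy : x ≤ y) (h : phiSlope q x ≤ 0) : phiSlope q y ≤ 0 := by
  by_contra! hy
  have hy0 : 0 < y := hx.trans_le hxy
  have hw : 0 ≤ 1 - x / y := by
    rw [sub_nonneg, div_le_one hy0]
    exact hxy
  have hc := (concaveOn_phiSlope hq).2 (Set.mem_Ici.2 le_rfl) (Set.mem_Ici.2 hy0.le) hw
    (div_nonneg hx.le hy0.le) (sub_add_cancel 1 (x / y))
  have h0 : phiSlope q 0 = 0 := by simp [phiSlope]
  simp only [smul_eq_mul, h0, mul_zero, zero_add, div_mul_cancel₀ x hy0.ne'] at hc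
  have : 0 < x / y * phiSlope q y := by positivity
  linarith

theorem antitoneOn_phi {q a : ℝ} (hq : q ∈ Set.Ioo (0 : ℝ) 1) (ha : 0 < a)
    (h : phiSlope q a ≤ 0) : AntitoneOn (phi q) (Set.Ici a) := by
  refine antitoneOn_of_hasDerivWithinAt_nonpos (convex_Ici a)
    (f' := fun x => q ^ x * phiSlope q x / (1 - q ^ x) ^ 3)
    (fun x hx => (hasDerivAt_phi hq (ha.trans_le hx)).continuousAt.continuousWithinAt)
    (fun x hx => (hasDerivAt_phi hq (ha.trans_le (interior_subset hx))).hasDerivWithinAt) ?_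
  intro x hx
  have hax : a ≤ x := interior_subset hx
  have hlt : q ^ x < 1 := Real.rpow_lt_one hq.1.le hq.2 (ha.trans_le hax)
  exact div_nonpos_of_nonpos_of_nonneg
    (mul_nonpos_of_nonneg_of_nonpos (Real.rpow_nonneg hq.1.le x)
      (phiSlope_nonpos_of_le hq ha hax h)) (pow_nonneg (by linarith) 3)

theorem monotoneOn_phi {q b : ℝ} (hq : q ∈ Set.Ioo (0 : ℝ) 1)
    (h : 0 < phiSlope q b) : MonotoneOn (phi q) (Set.Ioc 0 b) := by
  refine monotoneOn_of_hasDerivWithinAt_nonneg (convex_Ioc 0 b)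
    (f' := fun x => q ^ x * phiSlope q x / (1 - q ^ x) ^ 3)
    (fun x hx => (hasDerivAt_phi hq hx.1).continuousAt.continuousWithinAt)
    (fun x hx => (hasDerivAt_phi hq (interior_subset hx).1).hasDerivWithinAt) ?_
  intro x hx
  obtain ⟨hx0, hxb⟩ := interior_subset hx
  have hlt : q ^ x < 1 := Real.rpow_lt_one hq.1.le hq.2 hx0
  have hs : 0 ≤ phiSlope q x := by
    by_contra! hneg
    exact absurd (phiSlope_nonpos_of_le hq hx0 hxb hneg.le) h.not_ge
  exact div_nonneg (mul_nonneg (Real.rpow_nonneg hq.1.le x) hs) (pow_nonneg (by linarith) 3)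

theorem intervalIntegrable_phi {q a b : ℝ} (hq : q ∈ Set.Ioo (0 : ℝ) 1) (ha : 0 < a)
    (hab : a ≤ b) : IntervalIntegrable (phi q) MeasureTheory.volume a b := by
  refine ContinuousOn.intervalIntegrable_of_Icc hab fun x hx => ?_
  exact (hasDerivAt_phi hq (ha.trans_le hx.1)).continuousAt.continuousWithinAt

theorem sigmaQ_nonneg {q : ℝ} {j : ℕ} (hq : q ∈ Set.Ioo (0 : ℝ) 1) (hj : 1 ≤ j)
    (h : phiSlope q j ≤ 0) : 0 ≤ sigmaQ q j := by
  have hj0 : (0 : ℝ) < j := by exact_mod_cast hj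
  have hmono := intervalIntegral.integral_mono_on (a := (j : ℝ)) (b := (j : ℝ) + 1)
    (by linarith) (intervalIntegrable_const (c := phi q ((j : ℝ) + 1)))
    (intervalIntegrable_phi hq hj0 (by linarith)) fun x hx =>
      antitoneOn_phi hq hj0 h (Set.mem_Ici.2 hx.1) (Set.mem_Ici.2 (by linarith)) hx.2
  simp only [intervalIntegral.integral_const, add_sub_cancel_left, one_smul] at hmono
  exact sub_nonneg.2 hmono

theorem sigmaQ_nonpos {q : ℝ} {j : ℕ} (hq : q ∈ Set.Ioo (0 : ℝ) 1) (hj : 1 ≤ j)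
    (h : 0 < phiSlope q ((j : ℝ) + 1)) : sigmaQ q j ≤ 0 := by
  have hj0 : (0 : ℝ) < j := by exact_mod_cast hj
  have hmono := intervalIntegral.integral_mono_on (a := (j : ℝ)) (b := (j : ℝ) + 1)
    (by linarith) (intervalIntegrable_phi hq hj0 (by linarith))
    (intervalIntegrable_const (c := phi q ((j : ℝ) + 1))) fun x hx =>
      monotoneOn_phi hq h ⟨hj0.trans_le hx.1, hx.2⟩ ⟨by linarith, le_rfl⟩ hx.2
  simp only [intervalIntegral.integral_const, add_sub_cancel_left, one_smul] at hmono
  exact sub_nonpos.2 hmono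

/-- If `C_q(m) > 0` for some integer `m ≥ 1`, then `C_q(n) ≥ C_q(m)` for all `n ≥ m`. -/
theorem CQ_ge_of_pos (q : ℝ) (hq : q ∈ Set.Ioo (0 : ℝ) 1) (m : ℕ) (hm : 1 ≤ m)
    (hpos : 0 < CQ q m) : ∀ n : ℕ, m ≤ n → CQ q m ≤ CQ q n := by
  intro n hmn
  obtain ⟨j, hj, hσ⟩ : ∃ j ∈ Finset.Icc 1 m, 0 < sigmaQ q j := by
    by_contra! hall
    exact absurd (Finset.sum_nonpos hall) hpos.not_ge
  rw [Finset.mem_Icc] at hj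
  have hslope : phiSlope q ((j : ℝ) + 1) ≤ 0 := by
    by_contra! h
    exact absurd (sigmaQ_nonpos hq hj.1 h) hσ.not_ge
  refine Finset.sum_le_sum_of_subset_of_nonneg (Finset.Icc_subset_Icc_right hmn) ?_
  intro i hi him
  rw [Finset.mem_Icc] at hi him
  have hji : (j : ℝ) + 1 ≤ i := by
    have : j + 1 ≤ i := by omega
    exact_mod_cast this
  exact sigmaQ_nonneg hq hi.1 (phiSlope_nonpos_of_le hq (by positivity) hji hslope)
end
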